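/- (Nonconnected from connected, length 3.) Let μ = (μ₁, μ₂, μ₃) be a partition with three parts. Then for every d ≥ 0, H^d_G((μ₁,μ₂,μ₃)) = H̃^d_G((μ₁,μ₂,μ₃)) + (1/|aut(μ₁,μ₂,μ₃)|) · Σ_{k=0}^{d} [ |aut(μ₂,μ₃)| H^k_G((μ₁)) H^{d−k}_G((μ₂,μ₃)) + |aut(μ₁,μ₃)| H^k_G((μ₂)) H^{d−k}_G((μ₁,μ₃)) + |aut(μ₁,μ₂)| H^k_G((μ₃)) H^{d−k}_G((μ₁,μ₂)) − 2 Σ_{j=0}^{d−k} H^j_G((μ₁)) H^k_G((μ₂)) H^{d−j−k}_G((μ₃)) ], where for a finite multiset of positive integers |aut| := ∏_i m_i! with m_i the multiplicity of i, and where each weighted Hurwitz number on the right is attached to the partition formed by the indicated parts of μ (with base degree equal to the sum of those parts). -/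

import Mathlib

open scoped BigOperators

namespace WHN

/-- The cycle type of a permutation of `Fin N`, including fixed points as cycles of length 1. -/
def fullCycleType {N : ℕ} (h : Equiv.Perm (Fin N)) : Multiset ℕ :=
  h.cycleType + Multiset.replicate (N - h.cycleType.sum) 1

/-- The number of cycles of a permutation of `Fin N`, including fixed points. -/
def numCycles {N : ℕ} (h : Equiv.Perm (Fin N)) : ℕ :=
  (fullCycleType h).card

/-- The pure Hurwitz number `H(μ⁽¹⁾, …, μ⁽ᵏ⁾)`:  `1/N!` times the number of `k`-tuples of
permutations of `{1,…,N}` with the prescribed cycle types whose product is the identity. -/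
noncomputable def pureHurwitz {N k : ℕ} (μ : Fin k → N.Partition) : ℚ :=
  (Nat.card {h : Fin k → Equiv.Perm (Fin N) //
      (∀ i, fullCycleType (h i) = (μ i).parts) ∧ (List.ofFn h).prod = 1} : ℚ)
    / N.factorial

/-- The connected pure Hurwitz number `H̃(μ⁽¹⁾, …, μ⁽ᵏ⁾)`: only tuples generating a
transitive subgroup are counted. -/
noncomputable def connHurwitz {N k : ℕ} (μ : Fin k → N.Partition) : ℚ :=
  (Nat.card {h : Fin k → Equiv.Perm (Fin N) //
      (∀ i, fullCycleType (h i) = (μ i).parts) ∧ (List.ofFn h).prod = 1 ∧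
      ∀ x y : Fin N, ∃ g ∈ Subgroup.closure (Set.range h), g x = y} : ℚ)
    / N.factorial

/-- The colength `ℓ*(ν) = N - ℓ(ν)` of a partition `ν` of `N`. -/
def colength {N : ℕ} (ν : N.Partition) : ℕ := N - ν.parts.card

/-- `F_λ(μ)`: the sum of the pure Hurwitz numbers `H(μ⁽¹⁾, …, μ⁽ᵏ⁾, μ)` over all `k`-tuples of
partitions of `N` with colengths `ℓ*(μ⁽ʲ⁾) = ℓ j`. -/
noncomputable def Fsum (N : ℕ) (μ : N.Partition) {k : ℕ} (ℓ : Fin k → ℕ) : ℚ :=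
  ∑ ν ∈ Finset.univ.filter (fun ν : Fin k → N.Partition => ∀ j, colength (ν j) = ℓ j),
    pureHurwitz (Fin.snoc ν μ)

/-- `F̃_λ(μ)`: connected version of `Fsum`. -/
noncomputable def Fconn (N : ℕ) (μ : N.Partition) {k : ℕ} (ℓ : Fin k → ℕ) : ℚ :=
  ∑ ν ∈ Finset.univ.filter (fun ν : Fin k → N.Partition => ∀ j, colength (ν j) = ℓ j),
    connHurwitz (Fin.snoc ν μ)

/-- The parts of a partition, sorted in weakly decreasing order `λ₁ ≥ λ₂ ≥ ⋯ ≥ λ_k`. -/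
def sortedParts {d : ℕ} (lam : d.Partition) : List ℕ := lam.parts.sort (· ≥ ·)

/-- The evaluation `m_λ(c₁,…,c_L)` of the monomial symmetric polynomial in `L` variables. -/
noncomputable def msymmEval {R : Type*} [CommSemiring R] {L : ℕ} (c : Fin L → R) {d : ℕ}
    (lam : d.Partition) : R :=
  MvPolynomial.eval c (MvPolynomial.msymm (Fin L) R lam)

/-- The weighted Hurwitz number `H^d_G(μ) = Σ_{λ ⊢ d} m_λ(c) F_λ(μ)` for the weight
generating function `G(z) = ∏_{j=1}^L (1 + c_j z)`. -/
noncomputable def weightedH {R : Type*} [CommRing R] [Algebra ℚ R] {L : ℕ} (c : Fin L → R)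
    (d : ℕ) {N : ℕ} (μ : N.Partition) : R :=
  ∑ lam : d.Partition,
    msymmEval c lam * algebraMap ℚ R (Fsum N μ fun j => (sortedParts lam).get j)

/-- The connected weighted Hurwitz number `H̃^d_G(μ) = Σ_{λ ⊢ d} m_λ(c) F̃_λ(μ)`. -/
noncomputable def weightedHconn {R : Type*} [CommRing R] [Algebra ℚ R] {L : ℕ} (c : Fin L → R)
    (d : ℕ) {N : ℕ} (μ : N.Partition) : R :=
  ∑ lam : d.Partition,
    msymmEval c lam * algebraMap ℚ R (Fconn N μ fun j => (sortedParts lam).get j)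

/-- The coefficient `ρ^d_{ab}` of `β^d` in
`ρ_{ab}(β) = (−1)^b (a! b! (a+b+1))⁻¹ ∏_{i=−b}^{a} G(iβ)`, for `G(z) = ∏_j (1 + c_j z)`. -/
noncomputable def rhoCoeff {R : Type*} [CommRing R] [Algebra ℚ R] {L : ℕ} (c : Fin L → R)
    (a b d : ℕ) : R :=
  algebraMap ℚ R ((-1 : ℚ) ^ b * ((a.factorial * b.factorial * (a + b + 1) : ℕ) : ℚ)⁻¹) *
    (∏ i ∈ Finset.Icc (-(b : ℤ)) (a : ℤ),
        ∏ j, (1 + Polynomial.C ((i : R) * c j) * Polynomial.X)).coeff d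

/-- The partition `(1^N)` of `N` with all parts equal to `1`. -/
def onesPartition (N : ℕ) : N.Partition :=
  ⟨Multiset.replicate N 1, fun hi => by simp [Multiset.eq_of_mem_replicate hi], by simp⟩

/-- The one-part partition `(μ₁)` of `μ₁`. -/
def part1 (m1 : ℕ) : m1.Partition := Nat.Partition.indiscrete m1

/-- The two-part partition `(μ₁, μ₂)` of `μ₁ + μ₂`. -/
def part2 (m1 m2 : ℕ) (h1 : 0 < m1) (h2 : 0 < m2) : (m1 + m2).Partition :=
  ⟨{m1, m2}, fun hi => by
      rcases Multiset.mem_cons.mp hi with h | h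
      · simpa [h] using h1
      · simp only [Multiset.mem_singleton] at h; simpa [h] using h2, by
    simp [Multiset.sum_cons]⟩

/-- The three-part partition `(μ₁, μ₂, μ₃)` of `μ₁ + μ₂ + μ₃`. -/
def part3 (m1 m2 m3 : ℕ) (h1 : 0 < m1) (h2 : 0 < m2) (h3 : 0 < m3) :
    (m1 + m2 + m3).Partition :=
  ⟨{m1, m2, m3}, fun hi => by
      rcases Multiset.mem_cons.mp hi with h | h
      · simpa [h] using h1
      rcases Multiset.mem_cons.mp h with h' | h'
      · simpa [h'] using h2
      · simp only [Multiset.mem_singleton] at h'; simpa [h'] using h3, by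
    simp [Multiset.sum_cons]; ring⟩

/-- `|aut(λ)| = ∏_i m_i(λ)!` where `m_i(λ)` is the multiplicity of `i`. -/
def autCard (m : Multiset ℕ) : ℕ :=
  m.toFinset.prod fun i => (m.count i).factorial

end WHN



namespace WHN

open Equiv

section Counting

variable {α : Type*} [Fintype α] [DecidableEq α]

/-- The cycle type of a permutation of a finite type, fixed points included. -/
def cycType (p : Perm α) : Multiset ℕ :=
  p.cycleType + Multiset.replicate (Fintype.card α - p.cycleType.sum) 1

/-- The colength of a permutation: the number of points minus the number of cycles. -/
def colen (p : Perm α) : ℕ := p.cycleType.sum - Multiset.card p.cycleType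

lemma card_cycleType_le_sum (p : Perm α) :
    Multiset.card p.cycleType ≤ p.cycleType.sum := by
  have h := Multiset.card_nsmul_le_sum (s := p.cycleType) (a := 1)
    fun x hx => (Perm.one_lt_of_mem_cycleType hx).le
  simpa using h

lemma colen_eq_zero {p : Perm α} : colen p = 0 ↔ p = 1 := by
  constructor
  · intro h
    have h2 := Multiset.card_nsmul_le_sum (s := p.cycleType) (a := 2)
      fun x hx => Perm.two_le_of_mem_cycleType hx
    simp only [colen, smul_eq_mul] at h h2
    exact Perm.card_cycleType_eq_zero.1 (by omega)
  · rintro rfl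
    simp [colen]

lemma colen_conj (x y : Perm α) : colen (x * y * x⁻¹) = colen y := by
  simp only [colen, Perm.cycleType_conj]

lemma sum_cycType (p : Perm α) : (cycType p).sum = Fintype.card α := by
  have := p.sum_cycleType_le
  simp only [cycType, Multiset.sum_add, Multiset.sum_replicate, smul_eq_mul]
  omega

lemma colen_eq_card_sub (p : Perm α) :
    colen p = Fintype.card α - Multiset.card (cycType p) := by
  have := p.sum_cycleType_le
  have := card_cycleType_le_sum p
  simp only [cycType, colen, Multiset.card_add, Multiset.card_replicate]
  omega

lemma cycType_inv (p : Perm α) : cycType p⁻¹ = cycType p := by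
  simp [cycType]

lemma one_le_of_mem_cycType {p : Perm α} {n : ℕ} (hn : n ∈ cycType p) : 1 ≤ n := by
  rcases Multiset.mem_add.1 hn with h | h
  · exact (Perm.one_lt_of_mem_cycleType h).le
  · exact (Multiset.eq_of_mem_replicate h).ge

/-- The sum of `f (x₁ ⋯ x_k) ⟨x₁, …, x_k⟩` over all sequences of permutations whose colengths
form the given list. -/
noncomputable def sumColen : List ℕ → (Perm α → Subgroup (Perm α) → ℚ) → ℚ
  | [], f => f 1 ⊥
  | a :: l, f => ∑ x : Perm α with colen x = a,
      sumColen l fun p H => f (x * p) (Subgroup.closure {x} ⊔ H)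

lemma sumColen_zero_cons (l : List ℕ) (f : Perm α → Subgroup (Perm α) → ℚ) :
    sumColen (0 :: l) f = sumColen l f := by
  have : (Finset.univ.filter fun x : Perm α => colen x = 0) = {1} := by
    ext x; simp [colen_eq_zero]
  simp [sumColen, this]

lemma sumColen_perm {l l' : List ℕ} (h : l.Perm l') :
    ∀ f : Perm α → Subgroup (Perm α) → ℚ, sumColen l f = sumColen l' f := by
  induction h with
  | nil => intro f; rfl
  | cons a _ ih => intro f; simp only [sumColen, ih]
  | swap a b l =>
    intro f
    simp only [sumColen]
    rw [Finset.sum_comm]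
    conv_rhs => rw [Finset.sum_comm]
    conv_lhs => rw [Finset.sum_comm]
    conv_rhs => rw [Finset.sum_comm]
    rw [Finset.sum_comm]
    refine Finset.sum_congr rfl fun x _ => ?_
    refine Finset.sum_bij' (fun y _ => x⁻¹ * y * x) (fun y _ => x * y * x⁻¹) ?_ ?_ ?_ ?_ ?_
    · intro y hy
      simpa using (colen_conj x⁻¹ y).trans (by simpa using hy)
    · intro y hy
      simpa using (colen_conj x y).trans (by simpa using hy)
    · intro y _; simp [mul_assoc]
    · intro y _; simp [mul_assoc]
    · intro y _
      congr 1
      funext p H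
      congr 1
      · simp [mul_assoc]
      · rw [← sup_assoc, ← sup_assoc, ← Subgroup.closure_union, ← Subgroup.closure_union]
        congr 1
        have hx {K : Subgroup (Perm α)} : x ∈ K → (x⁻¹ * y * x ∈ K ↔ y ∈ K) := fun h => by
          rw [mul_mem_cancel_right h, mul_mem_cancel_left (inv_mem h)]
        apply le_antisymm <;> rw [Subgroup.closure_le] <;> rintro z (rfl | rfl)
        · exact (hx (Subgroup.subset_closure (by simp))).1 (Subgroup.subset_closure (by simp))
        · exact Subgroup.subset_closure (by simp)
        · exact Subgroup.subset_closure (by simp)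
        · exact (hx (Subgroup.subset_closure (by simp))).2 (Subgroup.subset_closure (by simp))
  | trans _ _ ih ih' => intro f; rw [ih, ih']

lemma sumColen_ofFn {k : ℕ} (e : Fin k → ℕ) (f : Perm α → Subgroup (Perm α) → ℚ) :
    sumColen (List.ofFn e) f = ∑ g : Fin k → Perm α with ∀ j, colen (g j) = e j,
      f (List.ofFn g).prod (Subgroup.closure (Set.range g)) := by
  induction k generalizing f with
  | zero => simp [sumColen]
  | succ k ih =>
    rw [List.ofFn_succ, sumColen]
    simp_rw [ih]
    rw [← Finset.sum_product']
    refine Finset.sum_bij' (fun x _ => Fin.cons x.1 x.2) (fun g _ => (g 0, Fin.tail g))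
      ?_ ?_ ?_ ?_ ?_
    · rintro ⟨x, g⟩ h
      simpa [Fin.forall_fin_succ] using h
    · intro g h
      simpa [Fin.forall_fin_succ, Fin.tail] using h
    · rintro ⟨x, g⟩ _; simp
    · intro g _; simp
    · rintro ⟨x, g⟩ _
      simp only [List.ofFn_succ, Fin.cons_zero, Fin.cons_succ, List.prod_cons, Fin.range_cons]
      rw [Set.insert_eq, Subgroup.closure_union]

end Counting

lemma sum_msymmEval {R : Type*} [CommRing R] [Algebra ℚ R] {L : ℕ} (c : Fin L → R) (d : ℕ)
    (f : List ℕ → R) (hperm : ∀ l l' : List ℕ, l.Perm l' → f l = f l')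
    (hzero : ∀ l, f (0 :: l) = f l) :
    ∑ lam : d.Partition, msymmEval c lam * f (sortedParts lam) =
      ∑ e ∈ Finset.univ.piAntidiag d, (∏ j, c j ^ e j) * f (List.ofFn e) := by
  have hfilter : ∀ l : List ℕ, f (l.filter (· ≠ 0)) = f l := by
    have key : ∀ l l' : List ℕ, f (l' ++ l.filter (· ≠ 0)) = f (l' ++ l) := by
      intro l
      induction l with
      | nil => simp
      | cons a l ih =>
        intro l'
        by_cases ha : a = 0
        · subst ha
          rw [hperm (l' ++ 0 :: l) (0 :: (l' ++ l)) List.perm_middle, hzero]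
          simpa using ih l'
        · simpa [ha] using ih (l' ++ [a])
    exact fun l => key l []
  have h1 : ∀ lam : d.Partition, msymmEval c lam * f (sortedParts lam) =
      ∑ s : Sym (Fin L) d with Nat.Partition.ofSym s = lam,
        ((s : Multiset (Fin L)).map c).prod * f (sortedParts (Nat.Partition.ofSym s)) := by
    intro lam
    rw [msymmEval, MvPolynomial.msymm, map_sum, Finset.sum_mul,
      Finset.sum_subtype (p := fun s => Nat.Partition.ofSym s = lam) _ (by simp)]
    refine Finset.sum_congr rfl fun s _ => ?_
    rw [s.2, map_multiset_prod, Multiset.map_map]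
    simp
  simp_rw [h1]
  rw [Finset.sum_fiberwise]
  let _ : Fintype {P : Fin L → ℕ // ∑ i, P i = d} :=
    Fintype.ofEquiv _ (Sym.equivNatSumOfFintype (Fin L) d)
  rw [Finset.sum_subtype (p := fun e : Fin L → ℕ => ∑ j, e j = d) _ (by simp)]
  refine Fintype.sum_equiv (Sym.equivNatSumOfFintype (Fin L) d) _ _ fun s => ?_
  congr 1
  · rw [Finset.prod_multiset_map_count]
    refine Finset.prod_subset (Finset.subset_univ _) fun j _ hj => ?_
    rw [Multiset.count_eq_zero.2 (by simpa using hj), pow_zero]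
  · rw [← hfilter (List.ofFn _)]
    apply hperm
    rw [← Multiset.coe_eq_coe, sortedParts, Multiset.sort_eq, ← Multiset.filter_coe,
      List.ofFn_eq_map, ← Multiset.map_coe,
      show (↑(List.finRange L) : Multiset (Fin L)) = Finset.univ.val from rfl,
      Multiset.filter_map]
    simp only [Nat.Partition.ofSym, Sym.val_eq_coe]
    refine congrArg₂ _ (funext fun _ => by simp) ?_
    rw [← Finset.filter_val, ← Multiset.toFinset_val]
    congr 1
    ext j
    simp

end WHN

namespace WHN

open Equiv

lemma fullCycleType_eq_cycType {N : ℕ} (p : Perm (Fin N)) : fullCycleType p = cycType p := by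
  simp [fullCycleType, cycType]

/-- The partition of `N` given by the cycle lengths of a permutation of `Fin N`. -/
def cyclePartition {N : ℕ} (p : Perm (Fin N)) : N.Partition :=
  ⟨cycType p, fun hi => one_le_of_mem_cycType hi, by simp [sum_cycType]⟩

lemma colength_cyclePartition {N : ℕ} (p : Perm (Fin N)) :
    colength (cyclePartition p) = colen p := by
  simp [colength, colen_eq_card_sub, cyclePartition]

lemma closure_range_snoc {G : Type*} [Group G] {k : ℕ} (g : Fin k → G) :
    Subgroup.closure (Set.range (Fin.snoc g (List.ofFn g).prod⁻¹ : Fin (k + 1) → G)) =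
      Subgroup.closure (Set.range g) := by
  rw [Fin.range_snoc, Set.insert_eq, Subgroup.closure_union, sup_eq_right, Subgroup.closure_le,
    Set.singleton_subset_iff]
  refine inv_mem (Subgroup.list_prod_mem _ fun x hx => Subgroup.subset_closure ?_)
  simpa [List.mem_ofFn] using hx

lemma sum_card_snoc {N : ℕ} (μ : N.Partition) {k : ℕ} (ℓ : Fin k → ℕ)
    (Q : Subgroup (Perm (Fin N)) → Prop) [DecidablePred Q] :
    ∑ ν ∈ Finset.univ.filter (fun ν : Fin k → N.Partition => ∀ j, colength (ν j) = ℓ j),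
      (Nat.card {h : Fin (k + 1) → Perm (Fin N) //
        (∀ i, fullCycleType (h i) = ((Fin.snoc ν μ : Fin (k + 1) → N.Partition) i).parts) ∧
          (List.ofFn h).prod = 1 ∧ Q (Subgroup.closure (Set.range h))} : ℚ) =
    sumColen (List.ofFn ℓ) fun p H => if cycType p = μ.parts ∧ Q H then 1 else 0 := by
  classical
  rw [sumColen_ofFn, ← Finset.sum_filter, Finset.sum_const, nsmul_one, ← Nat.cast_sum]
  congr 1
  rw [Finset.card_eq_sum_card_fiberwise (f := fun g j => cyclePartition (g j))
    (t := Finset.univ.filter (fun ν : Fin k → N.Partition => ∀ j, colength (ν j) = ℓ j))]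
  · refine Finset.sum_congr rfl fun ν hν => ?_
    rw [Nat.card_eq_fintype_card, Fintype.card_subtype]
    have hν : ∀ j, colength (ν j) = ℓ j := by simpa using hν
    have hprod : ∀ h : Fin (k + 1) → Perm (Fin N), (List.ofFn h).prod = 1 →
        (List.ofFn (Fin.init h)).prod⁻¹ = h (Fin.last k) := by
      intro h hh
      rw [List.ofFn_succ', List.concat_eq_append, List.prod_append, List.prod_singleton] at hh
      exact inv_eq_of_mul_eq_one_right hh
    refine Finset.card_bij' (fun h _ => Fin.init h)
      (fun g _ => Fin.snoc g (List.ofFn g).prod⁻¹) ?_ ?_ ?_ ?_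
    · intro h hh
      simp only [Finset.mem_filter, Finset.mem_univ, true_and] at hh ⊢
      obtain ⟨h1, h2, h3⟩ := hh
      have h4 : (fun j => cyclePartition (Fin.init h j)) = ν := by
        funext j
        ext1
        have := h1 j.castSucc
        rw [Fin.snoc_castSucc] at this
        rw [← this, fullCycleType_eq_cycType]
        rfl
      have h5 := h1 (Fin.last k)
      rw [← hprod h h2, Fin.snoc_last, fullCycleType_eq_cycType, cycType_inv] at h5
      have h6 := closure_range_snoc (Fin.init h)
      rw [hprod h h2, Fin.snoc_init_self] at h6
      refine ⟨⟨?_, h5, h6 ▸ h3⟩, h4⟩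
      intro j
      rw [← hν j, ← h4, colength_cyclePartition]
    · intro g hg
      simp only [Finset.mem_filter, Finset.mem_univ, true_and] at hg ⊢
      obtain ⟨⟨h1, h2, h3⟩, h4⟩ := hg
      refine ⟨?_, ?_, ?_⟩
      · intro i
        refine Fin.lastCases ?_ (fun j => ?_) i
        · rw [Fin.snoc_last, Fin.snoc_last, fullCycleType_eq_cycType, cycType_inv, h2]
        · rw [Fin.snoc_castSucc, Fin.snoc_castSucc, fullCycleType_eq_cycType, ← h4]
          rfl
      · rw [List.ofFn_succ', List.concat_eq_append, List.prod_append, List.prod_singleton]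
        simp
      · rwa [closure_range_snoc]
    · intro h hh
      simp only [Finset.mem_filter, Finset.mem_univ, true_and] at hh
      rw [hprod h hh.2.1, Fin.snoc_init_self]
    · intro g _
      exact Fin.init_snoc _ _
  · intro g hg
    simp only [Finset.coe_filter, Finset.mem_filter, Finset.mem_univ, true_and, Set.mem_ofPred_eq]
      at hg ⊢
    intro j
    rw [colength_cyclePartition, hg.1 j]

/-- A subgroup of permutations is transitive. -/
def ActsTransitively {α : Type*} (H : Subgroup (Perm α)) : Prop := ∀ x y, ∃ g ∈ H, g x = y

open scoped Classical in
lemma Fsum_eq {N : ℕ} (μ : N.Partition) {k : ℕ} (ℓ : Fin k → ℕ) :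
    Fsum N μ ℓ = (N.factorial : ℚ)⁻¹ *
      sumColen (List.ofFn ℓ) fun (p : Perm (Fin N)) _ => if cycType p = μ.parts ∧ True then 1 else 0 := by
  rw [← sum_card_snoc μ ℓ fun _ => True, Fsum, Finset.mul_sum]
  refine Finset.sum_congr rfl fun ν _ => ?_
  rw [pureHurwitz, div_eq_inv_mul]
  simp only [and_true]

open scoped Classical in
lemma Fconn_eq {N : ℕ} (μ : N.Partition) {k : ℕ} (ℓ : Fin k → ℕ) :
    Fconn N μ ℓ = (N.factorial : ℚ)⁻¹ *
      sumColen (List.ofFn ℓ) fun (p : Perm (Fin N)) H =>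
        if cycType p = μ.parts ∧ ActsTransitively H then 1 else 0 := by
  rw [← sum_card_snoc μ ℓ ActsTransitively, Fconn, Finset.mul_sum]
  refine Finset.sum_congr rfl fun ν _ => ?_
  rw [connHurwitz, div_eq_inv_mul]
  rfl

section Weight

variable {A : Type*} [CommRing A] {L : ℕ}

/-- The weight `∏ⱼ wⱼ ^ ℓ*(gⱼ)` of a tuple of permutations. -/
def wt {α : Type*} [Fintype α] [DecidableEq α] (w : Fin L → A) (g : Fin L → Perm α) : A :=
  ∏ j, w j ^ colen (g j)

open scoped Classical in
/-- The weighted number of tuples of permutations whose product has a given cycle type and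
which generate a subgroup with property `Q`. -/
noncomputable def tupleSum (w : Fin L → A) (α : Type*) [Fintype α] [DecidableEq α]
    (M : Multiset ℕ) (Q : Subgroup (Perm α) → Prop) : A :=
  ∑ g : Fin L → Perm α with
    cycType (List.ofFn g).prod = M ∧ Q (Subgroup.closure (Set.range g)), wt w g

variable {R : Type*} [CommRing R] [Algebra ℚ R]

open Polynomial in
open scoped Classical in
lemma sum_msymmEval_sumColen {N : ℕ} (c : Fin L → R) (d : ℕ) (M : Multiset ℕ) (r : ℚ)
    (Q : Subgroup (Perm (Fin N)) → Prop) :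
    ∑ lam : d.Partition, msymmEval c lam * algebraMap ℚ R (r *
      sumColen (sortedParts lam) fun p H => if cycType p = M ∧ Q H then 1 else 0) =
    (C (algebraMap ℚ R r) * tupleSum (fun j => C (c j) * X) (Fin N) M Q).coeff d := by
  rw [sum_msymmEval c d (fun l => algebraMap ℚ R (r *
      sumColen l fun p H => if cycType p = M ∧ Q H then 1 else 0))
    (fun l l' h => by rw [sumColen_perm h]) (fun l => by rw [sumColen_zero_cons])]
  simp only [coeff_C_mul, tupleSum, finsetSum_coeff, map_mul, Finset.mul_sum]
  have hwt : ∀ g : Fin L → Perm (Fin N), (wt (fun j => C (c j) * X) g).coeff d =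
      if ∑ j, colen (g j) = d then ∏ j, c j ^ colen (g j) else 0 := by
    intro g
    simp only [wt, mul_pow, Finset.prod_mul_distrib, Finset.prod_pow_eq_pow_sum, ← C_pow]
    rw [← map_prod, coeff_C_mul, coeff_X_pow]
    simp [eq_comm]
  simp_rw [hwt, sumColen_ofFn, map_sum, Finset.mul_sum]
  simp only [Finset.sum_filter]
  rw [Finset.sum_comm]
  refine Finset.sum_congr rfl fun g _ => ?_
  have hiff : ∀ e : Fin L → ℕ, (∀ j, colen (g j) = e j) ↔ (fun j => colen (g j)) = e :=
    fun e => funext_iff.symm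
  simp only [hiff, Finset.sum_ite_eq, Finset.mem_piAntidiag]
  by_cases h1 : ∑ j, colen (g j) = d <;>
    by_cases h2 : cycType (List.ofFn g).prod = M ∧ Q (Subgroup.closure (Set.range g)) <;>
    simp [h1, h2, mul_comm]

variable (c : Fin L → R)

open Polynomial in
/-- The generating polynomial of the weighted Hurwitz numbers of tuples with property `Q`. -/
noncomputable def genH (N : ℕ) (M : Multiset ℕ) (Q : Subgroup (Perm (Fin N)) → Prop) : R[X] :=
  C (algebraMap ℚ R (N.factorial : ℚ)⁻¹) * tupleSum (fun j => C (c j) * X) (Fin N) M Q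

lemma weightedH_eq_coeff (d : ℕ) {N : ℕ} (μ : N.Partition) :
    weightedH c d μ = (genH c N μ.parts fun _ => True).coeff d := by
  rw [genH, ← sum_msymmEval_sumColen]
  simp only [weightedH, Fsum_eq, List.ofFn_get, and_true]

lemma weightedHconn_eq_coeff (d : ℕ) {N : ℕ} (μ : N.Partition) :
    weightedHconn c d μ = (genH c N μ.parts ActsTransitively).coeff d := by
  rw [genH, ← sum_msymmEval_sumColen]
  simp only [weightedHconn, Fconn_eq, List.ofFn_get]

end Weight

end WHN

namespace WHN

open Equiv

section Transport

variable {α β : Type*}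

lemma sameCycle_permCongr (e : α ≃ β) (p : Perm α) (x y : β) :
    (e.permCongr p).SameCycle x y ↔ p.SameCycle (e.symm x) (e.symm y) := by
  refine exists_congr fun n => ?_
  have : (e.permCongr p) ^ n = e.permCongr (p ^ n) := (map_zpow e.permCongrHom p n).symm
  rw [this, Equiv.permCongr_apply, ← Equiv.eq_symm_apply]

lemma sumCongr_zpow (p : Perm α) (q : Perm β) (n : ℤ) :
    (Equiv.sumCongr p q : Perm (α ⊕ β)) ^ n = Equiv.sumCongr (p ^ n) (q ^ n) :=
  (map_zpow (Perm.sumCongrHom α β) (p, q) n).symm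

lemma sameCycle_sumCongr_inl (p : Perm α) (q : Perm β) (x y : α) :
    Perm.SameCycle (Equiv.sumCongr p q) (Sum.inl x) (Sum.inl y) ↔ p.SameCycle x y := by
  refine exists_congr fun n => ?_
  rw [sumCongr_zpow]
  simp

lemma sameCycle_sumCongr_inr (p : Perm α) (q : Perm β) (x y : β) :
    Perm.SameCycle (Equiv.sumCongr p q) (Sum.inr x) (Sum.inr y) ↔ q.SameCycle x y := by
  refine exists_congr fun n => ?_
  rw [sumCongr_zpow]
  simp

lemma prod_ofFn_permCongr (e : α ≃ β) {L : ℕ} (g : Fin L → Perm α) :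
    (List.ofFn fun j => e.permCongr (g j)).prod = e.permCongr (List.ofFn g).prod := by
  have := map_list_prod e.permCongrHom (List.ofFn g)
  rw [List.map_ofFn] at this
  exact this.symm

lemma prod_ofFn_sumCongr {L : ℕ} (g : Fin L → Perm α) (g' : Fin L → Perm β) :
    (List.ofFn fun j => (Equiv.sumCongr (g j) (g' j) : Perm (α ⊕ β))).prod =
      Equiv.sumCongr (List.ofFn g).prod (List.ofFn g').prod := by
  induction L with
  | zero => simp
  | succ L ih =>
    simp only [List.ofFn_succ, List.prod_cons]
    rw [ih (fun j => g j.succ) (fun j => g' j.succ), Perm.sumCongr_mul]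

variable [Fintype α] [DecidableEq α] [Fintype β] [DecidableEq β]

lemma cycleType_permCongr (e : α ≃ β) (p : Perm α) :
    (e.permCongr p).cycleType = p.cycleType := by
  rw [← Perm.cycleType_extendDomain (p := fun _ : β => True)
    (e.trans (Equiv.subtypeUnivEquiv fun _ => trivial).symm)]
  refine congrArg Perm.cycleType ?_
  ext b
  obtain ⟨a, rfl⟩ := e.surjective b
  have := Perm.extendDomain_apply_image p
    (e.trans (Equiv.subtypeUnivEquiv (p := fun _ : β => True) fun _ => trivial).symm) a
  simpa using this.symm

lemma cycleType_sumCongr_one (p : Perm α) :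
    Perm.cycleType (Equiv.sumCongr p (1 : Perm β)) = p.cycleType := by
  let f : α ≃ {x : α ⊕ β // x.isLeft} :=
    { toFun := fun a => ⟨Sum.inl a, rfl⟩
      invFun := fun x => x.1.getLeft x.2
      left_inv := fun a => rfl
      right_inv := fun x => by simp }
  rw [← Perm.cycleType_extendDomain f]
  congr 1
  ext x
  rcases x with a | b
  · exact (Perm.extendDomain_apply_image p f a).symm
  · rw [Perm.extendDomain_apply_not_subtype _ _ (by simp)]
    rfl

lemma cycleType_sumCongr (p : Perm α) (q : Perm β) :
    Perm.cycleType (Equiv.sumCongr p q) = p.cycleType + q.cycleType := by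
  have h1 : Equiv.sumCongr p q = Equiv.sumCongr p 1 * Equiv.sumCongr 1 q := by
    ext x; rcases x with a | b <;> rfl
  have h2 : Equiv.sumCongr (1 : Perm α) q =
      (Equiv.sumComm β α).permCongr (Equiv.sumCongr q 1) := by
    ext x; rcases x with a | b <;> rfl
  rw [h1, Perm.Disjoint.cycleType_mul, cycleType_sumCongr_one, h2, cycleType_permCongr,
    cycleType_sumCongr_one]
  intro x
  rcases x with a | b
  · right; rfl
  · left; rfl

lemma colen_permCongr (e : α ≃ β) (p : Perm α) : colen (e.permCongr p) = colen p := by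
  rw [colen, cycleType_permCongr, colen]

lemma colen_sumCongr (p : Perm α) (q : Perm β) :
    colen (Equiv.sumCongr p q) = colen p + colen q := by
  have := card_cycleType_le_sum p
  have := card_cycleType_le_sum q
  simp only [colen, cycleType_sumCongr, Multiset.sum_add, Multiset.card_add]
  omega

end Transport

section Label

variable {α β ι : Type*} [Fintype α] [Fintype β] [DecidableEq ι]

/-- `φ` labels the cycles of `p` bijectively by `ι`, the cycle with label `i` having length
`m i`. -/
structure IsLabel (p : Perm α) (m : ι → ℕ) (φ : α → ι) : Prop where
  apply_eq : ∀ x, φ (p x) = φ x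
  sameCycle : ∀ x y, φ x = φ y → p.SameCycle x y
  card_fiber : ∀ i, (Finset.univ.filter fun x => φ x = i).card = m i

variable {p : Perm α} {m : ι → ℕ} {φ : α → ι}

lemma IsLabel.eq_of_sameCycle (h : IsLabel p m φ) {x y : α} (hxy : p.SameCycle x y) :
    φ x = φ y := by
  have hinv : ∀ x, φ (p⁻¹ x) = φ x := fun x => by
    rw [← h.apply_eq (p⁻¹ x), Perm.inv_def, Equiv.apply_symm_apply]
  obtain ⟨n, rfl⟩ := hxy
  induction n using Int.induction_on with
  | zero => rfl
  | succ n ih => rw [ih, add_comm, zpow_add, zpow_one, Perm.mul_apply, h.apply_eq]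
  | pred n ih => rw [ih, sub_eq_neg_add, zpow_add, zpow_neg_one, Perm.mul_apply, hinv]

lemma IsLabel.surjective (h : IsLabel p m φ) (hm : ∀ i, 0 < m i) (i : ι) : ∃ x, φ x = i := by
  have := h.card_fiber i ▸ hm i
  obtain ⟨x, hx⟩ := Finset.card_pos.1 this
  exact ⟨x, by simpa using hx⟩

lemma IsLabel.permCongr (e : α ≃ β) (h : IsLabel p m φ) :
    IsLabel (e.permCongr p) m (φ ∘ e.symm) where
  apply_eq x := by simp [Equiv.permCongr_apply, h.apply_eq]
  sameCycle x y hxy := (sameCycle_permCongr e p x y).2 (h.sameCycle _ _ hxy)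
  card_fiber i := by
    rw [← h.card_fiber i]
    exact Finset.card_equiv e.symm (by simp)

lemma IsLabel.card_eq [Fintype ι] (h : IsLabel p m φ) : Fintype.card α = ∑ i, m i := by
  rw [← Finset.card_univ, Finset.card_eq_sum_card_fiberwise (f := φ) (t := Finset.univ) (by simp)]
  exact Finset.sum_congr rfl fun i _ => h.card_fiber i

variable [DecidableEq α]

lemma IsLabel.mem_support (h : IsLabel p m φ) (x : α) : x ∈ p.support ↔ 2 ≤ m (φ x) := by
  rw [← h.card_fiber, Perm.mem_support]
  constructor
  · intro hx
    exact Finset.one_lt_card.2 ⟨p x, by simp [h.apply_eq], x, by simp, hx⟩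
  · intro hx hfix
    obtain ⟨y, hy, hne⟩ := Finset.exists_mem_ne hx x
    have := h.sameCycle x y (by simpa using (Finset.mem_filter.1 hy).2.symm)
    obtain ⟨n, hn⟩ := this
    exact hne (by rw [← hn, Perm.zpow_apply_eq_self_of_apply_eq_self hfix])

variable [Fintype ι]

lemma IsLabel.cycType_eq (h : IsLabel p m φ) (hm : ∀ i, 0 < m i) :
    cycType p = Finset.univ.val.map m := by
  choose x hx using h.surjective hm
  let s : Finset ι := Finset.univ.filter fun i => 2 ≤ m i
  have hsupp : ∀ i ∈ s, (p.cycleOf (x i)).support = Finset.univ.filter fun y => φ y = i := by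
    intro i hi
    ext y
    rw [Perm.mem_support_cycleOf_iff, h.mem_support, hx]
    simp only [s, Finset.mem_filter, Finset.mem_univ, true_and] at hi ⊢
    refine ⟨fun hy => ?_, fun hy => ⟨h.sameCycle _ _ (by rw [hx, hy]), hi⟩⟩
    rw [← h.eq_of_sameCycle hy.1, hx]
  have hfac : p.cycleFactorsFinset = s.image fun i => p.cycleOf (x i) := by
    ext c
    simp only [Finset.mem_image]
    constructor
    · intro hc
      obtain ⟨y, hy⟩ := (Perm.mem_cycleFactorsFinset_iff.1 hc).1.nonempty_support
      have hyp : y ∈ p.support := Perm.mem_cycleFactorsFinset_support_le hc hy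
      refine ⟨φ y, ?_, ?_⟩
      · simpa [s] using (h.mem_support y).1 hyp
      · rw [Perm.cycle_is_cycleOf hy hc]
        exact (h.sameCycle _ _ (hx _)).cycleOf_eq
    · rintro ⟨i, hi, rfl⟩
      rw [Perm.cycleOf_mem_cycleFactorsFinset_iff, h.mem_support, hx]
      simpa [s] using hi
  have hinj : Set.InjOn (fun i => p.cycleOf (x i)) (s : Set ι) := by
    intro i hi j hj hij
    have h1 : x i ∈ (p.cycleOf (x i)).support := by rw [hsupp i hi]; simp [hx]
    have hij' : p.cycleOf (x i) = p.cycleOf (x j) := hij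
    rw [hij', hsupp j hj] at h1
    simpa [hx] using h1
  have hct : p.cycleType = s.val.map m := by
    rw [Perm.cycleType_def, hfac, Finset.image_val_of_injOn hinj, Multiset.map_map]
    refine Multiset.map_congr rfl fun i hi => ?_
    simp only [Function.comp_apply]
    rw [hsupp i hi, h.card_fiber]
  have hone : (sᶜ).val.map m = Multiset.replicate (sᶜ).card 1 := by
    rw [Multiset.eq_replicate]
    refine ⟨by simp, fun n hn => ?_⟩
    obtain ⟨i, hi, rfl⟩ := Multiset.mem_map.1 hn
    have h1 : ¬ 2 ≤ m i := by simpa [s] using hi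
    have := hm i
    omega
  have hsplit : (Finset.univ.val.map m) = s.val.map m + (sᶜ).val.map m := by
    rw [← Multiset.map_add, ← Finset.union_compl s,
      ← Finset.disjUnion_eq_union _ _ disjoint_compl_right]
    rfl
  have hcard : Fintype.card α = (s.val.map m).sum + (sᶜ).card := by
    rw [h.card_eq, Finset.sum, hsplit, hone]
    simp
  rw [cycType, hct, hsplit, hone, hcard, Nat.add_sub_cancel_left]

lemma isLabel_sigma (m : ι → ℕ) :
    IsLabel (Equiv.sigmaCongrRight fun i => finRotate (m i)) m
      (Sigma.fst : (Σ i, Fin (m i)) → ι) where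
  apply_eq x := rfl
  sameCycle := by
    have hpow : ∀ (i : ι) (n : ℕ) (a : Fin (m i)),
        ((Equiv.sigmaCongrRight fun i => finRotate (m i) : Perm (Σ i, Fin (m i))) ^ n) ⟨i, a⟩ =
          ⟨i, ((finRotate (m i)) ^ n) a⟩ := by
      intro i n
      induction n with
      | zero => intro a; rfl
      | succ n ih => intro a; rw [pow_succ, pow_succ, Perm.mul_apply, Perm.mul_apply, ← ih]; rfl
    have hrot : ∀ (k : ℕ) (a b : Fin k), ∃ n : ℕ, ((finRotate k) ^ n) a = b := by
      intro k a b
      rcases k with _ | k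
      · exact a.elim0
      · refine ⟨(b - a).val, ?_⟩
        have : ∀ n : ℕ, ((finRotate (k + 1)) ^ n) a = a + Fin.ofNat (k + 1) n := by
          intro n
          induction n with
          | zero => simp
          | succ n ih =>
            rw [pow_succ', Perm.mul_apply, ih, finRotate_apply]
            simp [Fin.ext_iff, Fin.val_add]
            ring_nf
        rw [this]
        simp
    rintro ⟨i, a⟩ ⟨j, b⟩ h
    obtain rfl : i = j := h
    obtain ⟨n, hn⟩ := hrot _ a b
    exact ⟨n, by rw [zpow_natCast, hpow, hn]⟩
  card_fiber i := by
    rw [Finset.card_filter, Fintype.sum_sigma]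
    have h : ∀ j, (∑ _x : Fin (m j), if j = i then 1 else 0) = if j = i then m j else 0 := by
      intro j
      split_ifs <;> simp
    refine (Finset.sum_congr rfl fun j _ => h j).trans ?_
    rw [Finset.sum_ite_eq' Finset.univ i m, if_pos (Finset.mem_univ i)]

lemma exists_isLabel (hm : ∀ i, 0 < m i) (h : cycType p = Finset.univ.val.map m) :
    ∃ φ, IsLabel p m φ := by
  have hcard : Fintype.card (Σ i, Fin (m i)) = Fintype.card α := by
    rw [← sum_cycType p, h]
    rw [Fintype.card_sigma, Finset.sum]
    simp only [Fintype.card_fin]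
  have hl := (isLabel_sigma m).permCongr (Fintype.equivOfCardEq hcard)
  set q := (Fintype.equivOfCardEq hcard).permCongr
    (Equiv.sigmaCongrRight fun i => finRotate (m i)) with hq
  have hct : ∀ r : Perm α, (cycType r).filter (2 ≤ ·) = r.cycleType := by
    intro r
    rw [cycType, Multiset.filter_add, Multiset.filter_eq_self.2, Multiset.filter_eq_nil.2, add_zero]
    · intro a ha
      rw [Multiset.eq_of_mem_replicate ha]
      norm_num
    · exact fun a ha => Perm.two_le_of_mem_cycleType ha
  have hconj : IsConj q p := Perm.isConj_iff_cycleType_eq.2 <| by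
    rw [← hct q, ← hct p, h, hl.cycType_eq hm]
  obtain ⟨c, hc⟩ := isConj_iff.1 hconj
  have := hl.permCongr c
  rw [Equiv.permCongr_eq_mul, hc] at this
  exact ⟨_, this⟩

lemma card_isLabel [DecidablePred (IsLabel p m)] (hm : ∀ i, 0 < m i) :
    (Finset.univ.filter fun φ : α → ι => IsLabel p m φ).card =
      if cycType p = Finset.univ.val.map m then autCard (Finset.univ.val.map m) else 0 := by
  split_ifs with h
  swap
  · rw [Finset.card_eq_zero, Finset.filter_eq_empty_iff]
    exact fun φ _ hφ => h (hφ.cycType_eq hm)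
  obtain ⟨φ₀, h₀⟩ := exists_isLabel hm h
  have haut : autCard (Finset.univ.val.map m) = Fintype.card {e : Perm ι // m ∘ e = m} := by
    rw [DomMulAct.stabilizer_card', autCard]
    refine Finset.prod_congr rfl fun n _ => ?_
    rw [Multiset.count_map, Fintype.card_subtype]
    simp only [eq_comm]
    rfl
  rw [haut, Fintype.card_subtype]
  choose x hx using h₀.surjective hm
  symm
  refine Finset.card_bij (fun e _ => e ∘ φ₀) ?_ ?_ ?_
  · intro e he
    have he : m ∘ e = m := by simpa using he
    refine Finset.mem_filter.2 ⟨Finset.mem_univ _, ?_, ?_, ?_⟩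
    · intro y; simp [h₀.apply_eq]
    · intro y z hyz
      exact h₀.sameCycle y z (e.injective hyz)
    · intro i
      have : m i = m (e.symm i) := by conv_rhs => rw [← he]; simp
      rw [this, ← h₀.card_fiber]
      simp [Equiv.eq_symm_apply]
  · intro e _ e' _ hee
    ext i
    rw [← hx i]
    exact congrFun hee (x i)
  · intro φ hφ
    have hφ : IsLabel p m φ := by simpa using hφ
    have key : ∀ y, φ (x (φ₀ y)) = φ y := fun y =>
      hφ.eq_of_sameCycle (h₀.sameCycle _ _ (hx _))
    have hinj : Function.Injective fun i => φ (x i) := by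
      intro i j hij
      rw [← hx i, ← hx j]
      exact h₀.eq_of_sameCycle (hφ.sameCycle _ _ hij)
    refine ⟨Equiv.ofBijective _ (Finite.injective_iff_bijective.1 hinj), ?_, ?_⟩
    · simp only [Finset.mem_filter, Finset.mem_univ, true_and]
      funext i
      simp only [Function.comp_apply, Equiv.ofBijective_apply]
      rw [← hφ.card_fiber, ← h₀.card_fiber]
      congr 1
      ext y
      simp only [Finset.mem_filter, Finset.mem_univ, true_and]
      rw [← key y]
      exact hinj.eq_iff
    · funext y
      exact key y

lemma cycType_eq_singleton_card_iff [Nonempty α] :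
    cycType p = {Fintype.card α} ↔ ∀ x y, p.SameCycle x y := by
  have hm : ∀ _ : Unit, 0 < Fintype.card α := fun _ => Fintype.card_pos
  have huniv : (Finset.univ.val.map fun _ : Unit => Fintype.card α) = {Fintype.card α} := rfl
  constructor
  · intro h
    obtain ⟨φ, hφ⟩ := exists_isLabel (p := p) hm (h.trans huniv.symm)
    exact fun x y => hφ.sameCycle x y rfl
  · intro h
    rw [← huniv]
    refine IsLabel.cycType_eq (φ := fun _ => ()) ⟨fun _ => rfl, fun x y _ => h x y, fun _ => ?_⟩ hm
    simp

end Label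

end WHN

namespace WHN

open Equiv

section Labelled

variable {A : Type*} [CommRing A] {L : ℕ} (w : Fin L → A)
variable {α β ι : Type*}

/-- For each label in `T`, the set of points with that label is preserved by all the
permutations `g j`. -/
def Separates (T : Set ι) (g : Fin L → Perm α) (φ : α → ι) : Prop :=
  ∀ k ∈ T, ∀ j x, φ (g j x) = k ↔ φ x = k

lemma separates_of_subsingleton [Subsingleton ι] (T : Set ι) (g : Fin L → Perm α) (φ : α → ι) :
    Separates T g φ :=
  fun _ _ _ _ => iff_of_true (Subsingleton.elim _ _) (Subsingleton.elim _ _)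

lemma separates_sumElim_iff {T : Set ι} {i : ι} (g : Fin L → Perm α) (g' : Fin L → Perm β)
    (φ : β → {k // k ≠ i}) :
    Separates T (fun j => (Equiv.sumCongr (g j) (g' j) : Perm (α ⊕ β)))
      (Sum.elim (fun _ => i) fun b => (φ b : ι)) ↔ Separates (Subtype.val ⁻¹' T) g' φ := by
  constructor
  · intro h k hk j x
    have := h k hk j (Sum.inr x)
    simpa [Subtype.ext_iff] using this
  · rintro h k hk j (x | x)
    · rfl
    · by_cases hki : k = i
      · subst hki
        exact iff_of_false (φ _).2 (φ _).2
      · have := h ⟨k, hki⟩ hk j x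
        simpa [Subtype.ext_iff] using this

variable [Fintype α] [Fintype β]

lemma exists_equiv_sum {γ : Type*} [Fintype γ] [DecidableEq γ] (C : Finset γ)
    (hC : C.card = Fintype.card α) (hγ : Fintype.card γ = Fintype.card α + Fintype.card β) :
    ∃ e : γ ≃ α ⊕ β, ∀ x, (e x).isLeft ↔ x ∈ C := by
  have h1 : Fintype.card {x // x ∈ C} = Fintype.card α := by rw [Fintype.card_coe, hC]
  have h2 : Fintype.card {x // x ∉ C} = Fintype.card β := by
    rw [Fintype.card_subtype_compl, h1, hγ, Nat.add_sub_cancel_left]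
  refine ⟨(Equiv.sumCompl (· ∈ C)).symm.trans
    (Equiv.sumCongr (Fintype.equivOfCardEq h1) (Fintype.equivOfCardEq h2)), fun x => ?_⟩
  by_cases hx : x ∈ C
  · simp [hx, Equiv.sumCompl_symm_apply_of_pos]
  · simp [hx, Equiv.sumCompl_symm_apply_of_neg]

variable [DecidableEq ι]

lemma isLabel_sumElim_iff {m : ι → ℕ} {i : ι} (hα : Fintype.card α = m i) (p : Perm α) (q : Perm β)
    (φ : β → {k // k ≠ i}) :
    IsLabel (Equiv.sumCongr p q) m (Sum.elim (fun _ => i) fun b => (φ b : ι)) ↔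
      (∀ x y, p.SameCycle x y) ∧ IsLabel q (m ∘ Subtype.val) φ := by
  constructor
  · intro h
    refine ⟨fun x y => (sameCycle_sumCongr_inl p q x y).1 (h.sameCycle _ _ rfl), ?_, ?_, ?_⟩
    · exact fun x => Subtype.ext (h.apply_eq (Sum.inr x))
    · intro x y hxy
      exact (sameCycle_sumCongr_inr p q x y).1 (h.sameCycle _ _ (by simp [hxy]))
    · intro k
      rw [Function.comp_apply, ← h.card_fiber, Finset.card_filter, Finset.card_filter,
        Fintype.sum_sum_type]
      simp [Subtype.ext_iff, k.2.symm]
      rw [Finset.card_filter]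
      congr!
  · rintro ⟨h1, h2⟩
    refine ⟨?_, ?_, ?_⟩
    · rintro (x | x)
      · rfl
      · simp [h2.apply_eq]
    · rintro (x | x) (y | y) hxy
      · exact (sameCycle_sumCongr_inl p q x y).2 (h1 x y)
      · exact absurd hxy.symm (φ y).2
      · exact absurd hxy (φ x).2
      · exact (sameCycle_sumCongr_inr p q x y).2 (h2.sameCycle x y (Subtype.ext hxy))
    · intro k
      rw [Finset.card_filter, Fintype.sum_sum_type]
      by_cases hk : k = i
      · subst hk
        simp [hα, fun b => (φ b).2]
      · have := h2.card_fiber ⟨k, hk⟩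
        rw [Finset.card_filter] at this
        simp only [Subtype.ext_iff, Function.comp_apply] at this
        simp [← this, Ne.symm hk]
        rw [Finset.card_filter]
        congr!

variable [DecidableEq α] [DecidableEq β] [Fintype ι]

open scoped Classical in
/-- The weighted number of tuples of permutations together with a labelling of the cycles of
their product, subject to a condition `P`. -/
noncomputable def labelSum (m : ι → ℕ) (P : (Fin L → Perm α) → (α → ι) → Prop) : A :=
  ∑ x : (Fin L → Perm α) × (α → ι) with IsLabel (List.ofFn x.1).prod m x.2 ∧ P x.1 x.2, wt w x.1

variable (m : ι → ℕ)

lemma labelSum_closure (hm : ∀ i, 0 < m i) (Q : Subgroup (Perm α) → Prop) :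
    labelSum w m (fun g (_ : α → ι) => Q (Subgroup.closure (Set.range g))) =
      (autCard (Finset.univ.val.map m) : A) * tupleSum w α (Finset.univ.val.map m) Q := by
  classical
  rw [labelSum, tupleSum, Finset.sum_filter, Fintype.sum_prod_type, Finset.sum_filter,
    Finset.mul_sum]
  refine Finset.sum_congr rfl fun g _ => ?_
  by_cases hQ : Q (Subgroup.closure (Set.range g))
  · simp only [hQ, and_true]
    rw [← Finset.sum_filter, Finset.sum_const, card_isLabel hm, nsmul_eq_mul]
    split_ifs <;> simp
  · simp [hQ]

lemma labelSum_congr {P P' : (Fin L → Perm α) → (α → ι) → Prop}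
    (h : ∀ g φ, IsLabel (List.ofFn g).prod m φ → (P g φ ↔ P' g φ)) :
    labelSum w m P = labelSum w m P' := by
  classical
  rw [labelSum, labelSum]
  congr 1
  exact Finset.filter_congr fun x _ => and_congr_right fun hx => h _ _ hx

lemma wt_permCongr (e : α ≃ β) (g : Fin L → Perm α) :
    wt w (fun j => e.permCongr (g j)) = wt w g := by
  simp only [wt, colen_permCongr]

lemma wt_sumCongr (g : Fin L → Perm α) (g' : Fin L → Perm β) :
    wt w (fun j => (Equiv.sumCongr (g j) (g' j) : Perm (α ⊕ β))) = wt w g * wt w g' := by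
  simp only [wt, colen_sumCongr, pow_add, Finset.prod_mul_distrib]

lemma labelSum_permCongr (e : α ≃ β) (P : (Fin L → Perm β) → (β → ι) → Prop) :
    labelSum w m (fun g φ => P (fun j => e.permCongr (g j)) (φ ∘ e.symm)) = labelSum w m P := by
  classical
  let E : (Fin L → Perm α) × (α → ι) ≃ (Fin L → Perm β) × (β → ι) :=
    Equiv.prodCongr (Equiv.arrowCongr (Equiv.refl _) e.permCongr)
      (Equiv.arrowCongr e (Equiv.refl _))
  have hE : ∀ x, E x = (fun j => e.permCongr (x.1 j), x.2 ∘ e.symm) := fun x => rfl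
  rw [labelSum, labelSum]
  refine Finset.sum_equiv E (fun x => ?_) (fun x _ => ?_)
  · simp only [Finset.mem_filter, Finset.mem_univ, true_and, hE]
    refine and_congr_left fun _ => ?_
    rw [prod_ofFn_permCongr]
    refine ⟨fun h => h.permCongr e, fun h => ?_⟩
    have := h.permCongr e.symm
    convert this using 1
    · ext; simp [Equiv.permCongr_apply]
    · ext; simp
  · rw [hE, wt_permCongr]

variable {m} {i : ι}

lemma labelSum_sum {T : Set ι} (hi : i ∈ T) (hm : 0 < m i) (hα : Fintype.card α = m i) :
    labelSum w m (fun (g : Fin L → Perm (α ⊕ β)) φ =>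
        Separates T g φ ∧ ∀ x, φ x = i ↔ x.isLeft) =
      tupleSum w α {m i} (fun _ => True) *
        labelSum w (m ∘ Subtype.val : {k // k ≠ i} → ℕ)
          (fun (g : Fin L → Perm β) φ => Separates (Subtype.val ⁻¹' T) g φ) := by
  classical
  have : Nonempty α := Fintype.card_pos_iff.1 (hα ▸ hm)
  rw [tupleSum, labelSum, labelSum, Finset.sum_mul_sum, ← Finset.sum_product', eq_comm]
  refine Finset.sum_bij
    (fun y _ => (fun j => (Equiv.sumCongr (y.1 j) (y.2.1 j) : Perm (α ⊕ β)),
      Sum.elim (fun _ => i) fun b => (y.2.2 b : ι))) ?_ ?_ ?_ ?_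
  · rintro ⟨g, g', φ⟩ hy
    simp only [Finset.mem_product, Finset.mem_filter, Finset.mem_univ, true_and, and_true] at hy ⊢
    obtain ⟨h1, h2, h3⟩ := hy
    rw [prod_ofFn_sumCongr, isLabel_sumElim_iff hα, separates_sumElim_iff]
    rw [← hα, cycType_eq_singleton_card_iff] at h1
    refine ⟨⟨h1, h2⟩, h3, ?_⟩
    rintro (x | x)
    · simp
    · simp [(φ x).2]
  · rintro ⟨g, g', φ⟩ _ ⟨f, f', ψ⟩ _ h
    simp only [Prod.mk.injEq] at h ⊢
    refine ⟨?_, ?_, ?_⟩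
    · funext j; ext x
      have := congrArg (fun e : Perm (α ⊕ β) => e (Sum.inl x)) (congrFun h.1 j)
      simpa using this
    · funext j; ext x
      have := congrArg (fun e : Perm (α ⊕ β) => e (Sum.inr x)) (congrFun h.1 j)
      simpa using this
    · funext x
      exact Subtype.ext (congrFun h.2 (Sum.inr x))
  · rintro ⟨g, φ⟩ hy
    simp only [Finset.mem_filter, Finset.mem_univ, true_and] at hy
    obtain ⟨h1, h2, h3⟩ := hy
    have hg : ∀ j, ∃ ab : Perm α × Perm β, Perm.sumCongrHom α β ab = g j := by
      intro j
      refine Perm.mem_sumCongrHom_range_of_perm_mapsTo_inl ?_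
      rintro _ ⟨x, rfl⟩
      have := (h3 (g j (Sum.inl x))).1 ((h2 i hi j _).2 ((h3 _).2 rfl))
      obtain ⟨y, hy⟩ := Sum.isLeft_iff.1 this
      exact ⟨y, hy.symm⟩
    choose ab hab using hg
    have hφ : ∀ b, φ (Sum.inr b) ≠ i := fun b hb => by simpa using (h3 _).1 hb
    have hgeq : (fun j => (Equiv.sumCongr (ab j).1 (ab j).2 : Perm (α ⊕ β))) = g :=
      funext fun j => hab j
    have hφeq : (Sum.elim (fun _ => i) fun b => φ (Sum.inr b)) = φ := by
      funext x
      rcases x with x | x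
      · exact ((h3 _).2 rfl).symm
      · rfl
    refine ⟨(fun j => (ab j).1, fun j => (ab j).2, fun b => ⟨φ (Sum.inr b), hφ b⟩), ?_, ?_⟩
    · rw [← hgeq, ← hφeq, prod_ofFn_sumCongr] at h1
      have h1' := (isLabel_sumElim_iff hα _ _ fun b => ⟨φ (Sum.inr b), hφ b⟩).1 h1
      rw [← hgeq, ← hφeq] at h2
      have h2' := (separates_sumElim_iff _ _ fun b => ⟨φ (Sum.inr b), hφ b⟩).1 h2
      simp only [Finset.mem_product, Finset.mem_filter, Finset.mem_univ, true_and, and_true]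
      refine ⟨?_, h1'.2, h2'⟩
      rw [← hα, cycType_eq_singleton_card_iff]
      exact h1'.1
    · exact Prod.ext hgeq hφeq
  · rintro ⟨g, g', φ⟩ _
    exact (wt_sumCongr w g g').symm


lemma labelSum_fiber_eq {γ : Type*} [Fintype γ] [DecidableEq γ] {T : Set ι} (hi : i ∈ T)
    (hm : 0 < m i) (hα : Fintype.card α = m i)
    (hγ : Fintype.card γ = Fintype.card α + Fintype.card β) {C : Finset γ} (hC : C.card = m i) :
    labelSum w m (fun (g : Fin L → Perm γ) φ => Separates T g φ ∧ ∀ x, φ x = i ↔ x ∈ C) =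
      tupleSum w α {m i} (fun _ => True) *
        labelSum w (m ∘ Subtype.val : {k // k ≠ i} → ℕ)
          (fun (g : Fin L → Perm β) φ => Separates (Subtype.val ⁻¹' T) g φ) := by
  obtain ⟨e, he⟩ := exists_equiv_sum (α := α) (β := β) C (hC.trans hα.symm) hγ
  rw [← labelSum_sum w hi hm hα, ← labelSum_permCongr w m e]
  refine labelSum_congr w m fun g φ _ => and_congr ?_ ?_
  · simp only [Separates, Equiv.permCongr_apply, Function.comp_apply, Equiv.symm_apply_apply]
    refine forall₂_congr fun k _ => forall_congr' fun j => ?_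
    exact e.forall_congr fun x => by simp
  · exact e.forall_congr fun x => by simp [he]

lemma labelSum_separates {γ : Type*} [Fintype γ] [DecidableEq γ] {T : Set ι} (hi : i ∈ T)
    (hm : 0 < m i) (hα : Fintype.card α = m i)
    (hγ : Fintype.card γ = Fintype.card α + Fintype.card β) :
    labelSum w m (fun (g : Fin L → Perm γ) φ => Separates T g φ) =
      ((Fintype.card γ).choose (m i) : A) * (tupleSum w α {m i} (fun _ => True) *
        labelSum w (m ∘ Subtype.val : {k // k ≠ i} → ℕ)
          (fun (g : Fin L → Perm β) φ => Separates (Subtype.val ⁻¹' T) g φ)) := by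
  classical
  rw [← nsmul_eq_mul, ← Finset.card_univ, ← Finset.card_powersetCard, ← Finset.sum_const]
  conv_lhs => rw [labelSum, ← Finset.sum_fiberwise_of_maps_to
    (g := fun x => Finset.univ.filter fun y => x.2 y = i)
    (t := Finset.powersetCard (m i) Finset.univ) (by
      intro x hx
      rw [Finset.mem_powersetCard]
      exact ⟨Finset.subset_univ _, (Finset.mem_filter.1 hx).2.1.card_fiber i⟩)]
  refine Finset.sum_congr rfl fun C hC => ?_
  rw [← labelSum_fiber_eq w hi hm hα hγ (Finset.mem_powersetCard.1 hC).2, labelSum,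
    Finset.filter_filter]
  refine Finset.sum_congr (Finset.ext fun x => ?_) fun _ _ => rfl
  simp [Finset.ext_iff, and_assoc]

end Labelled

end WHN

namespace WHN

open Equiv

section InclusionExclusion

variable {α ι : Type*} {L : ℕ}

lemma separates_iff_closure {T : Set ι} {g : Fin L → Perm α} {φ : α → ι} :
    Separates T g φ ↔
      ∀ k ∈ T, ∀ h ∈ Subgroup.closure (Set.range g), ∀ x, φ (h x) = k ↔ φ x = k := by
  constructor
  · intro hs k hk h hh
    induction hh using Subgroup.closure_induction with
    | mem h hh =>
      obtain ⟨j, rfl⟩ := hh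
      exact hs k hk j
    | one => exact fun x => Iff.rfl
    | mul a b _ _ ha hb => exact fun x => (ha (b x)).trans (hb x)
    | inv a _ ha =>
      intro x
      rw [← ha (a⁻¹ x), Perm.inv_def, Equiv.apply_symm_apply]
  · exact fun h k hk j => h k hk (g j) (Subgroup.subset_closure ⟨j, rfl⟩)

variable [Fintype α] [DecidableEq ι] {m : ι → ℕ} {g : Fin L → Perm α} {φ : α → ι}

lemma IsLabel.exists_mem_closure (h : IsLabel (List.ofFn g).prod m φ) {x y : α}
    (hxy : φ x = φ y) : ∃ a ∈ Subgroup.closure (Set.range g), a x = y := by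
  obtain ⟨n, hn⟩ := h.sameCycle x y hxy
  refine ⟨_, Subgroup.zpow_mem _ (Subgroup.list_prod_mem _ fun a ha => ?_) n, hn⟩
  obtain ⟨j, rfl⟩ := (List.mem_ofFn' _ _).1 ha
  exact Subgroup.subset_closure ⟨j, rfl⟩

open scoped Classical in
/-- The orbit structure on labels: a tuple acting on three labelled cycles is transitive, or
isolates exactly one label, or isolates all three. -/
lemma IsLabel.indicator_eq {A : Type*} [CommRing A] {m : Fin 3 → ℕ} {φ : α → Fin 3}
    (h : IsLabel (List.ofFn g).prod m φ) (hm : ∀ i, 0 < m i) :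
    (1 : A) = (if ActsTransitively (Subgroup.closure (Set.range g)) then 1 else 0) +
      ∑ i, (if Separates {i} g φ then 1 else 0) -
      2 * (if Separates Set.univ g φ then 1 else 0) := by
  choose x hx using h.surjective hm
  set G := Subgroup.closure (Set.range g) with hG
  let r : α → α → Prop := fun y z => ∃ a ∈ G, a y = z
  have rsymm : ∀ {y z}, r y z → r z y := by
    rintro y z ⟨a, ha, rfl⟩
    exact ⟨a⁻¹, G.inv_mem ha, by simp⟩
  have rtrans : ∀ {y z t}, r y z → r z t → r y t := by
    rintro y z t ⟨a, ha, rfl⟩ ⟨b, hb, rfl⟩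
    exact ⟨b * a, G.mul_mem hb ha, rfl⟩
  have rlabel : ∀ y, r y (x (φ y)) := fun y => h.exists_mem_closure (hx _).symm
  have htrans : ActsTransitively G ↔ ∀ i j, r (x i) (x j) :=
    ⟨fun H i j => H _ _, fun H y z =>
      rtrans (rlabel y) (rtrans (H (φ y) (φ z)) (rsymm (rlabel z)))⟩
  have hsep : ∀ T : Set (Fin 3), Separates T g φ ↔ ∀ k ∈ T, ∀ l, l ≠ k → ¬ r (x l) (x k) := by
    intro T
    rw [separates_iff_closure]
    refine forall₂_congr fun k _ => ⟨?_, ?_⟩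
    · rintro H l hlk ⟨a, ha, hal⟩
      have := H a ha (x l)
      rw [hal, hx, hx] at this
      exact hlk (this.1 rfl)
    · intro H a ha y
      have hy : r (x (φ y)) (x (φ (a y))) :=
        rtrans (rsymm (rlabel y)) (rtrans ⟨a, ha, rfl⟩ (rlabel (a y)))
      constructor
      · intro hk
        by_contra hne
        exact H _ hne (hk ▸ hy)
      · intro hk
        by_contra hne
        exact H _ hne (hk ▸ rsymm hy)
  have rrefl : ∀ y, r y y := fun y => ⟨1, G.one_mem, rfl⟩
  have s01 : r (x 1) (x 0) ↔ r (x 0) (x 1) := ⟨rsymm, rsymm⟩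
  have s02 : r (x 2) (x 0) ↔ r (x 0) (x 2) := ⟨rsymm, rsymm⟩
  have s12 : r (x 2) (x 1) ↔ r (x 1) (x 2) := ⟨rsymm, rsymm⟩
  have t1 : r (x 0) (x 1) → r (x 1) (x 2) → r (x 0) (x 2) := rtrans
  have t2 : r (x 0) (x 1) → r (x 0) (x 2) → r (x 1) (x 2) := fun h1 h2 => rtrans (rsymm h1) h2
  have t3 : r (x 0) (x 2) → r (x 1) (x 2) → r (x 0) (x 1) := fun h1 h2 => rtrans h1 (rsymm h2)
  simp only [htrans, hsep, Fin.sum_univ_three, Fin.forall_fin_succ, Set.mem_singleton_iff,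
    Set.mem_univ, forall_true_left, forall_eq, rrefl]
  by_cases h1 : r (x 0) (x 1) <;> by_cases h2 : r (x 0) (x 2) <;> by_cases h3 : r (x 1) (x 2) <;>
    simp_all
  norm_num

variable {A : Type*} [CommRing A] (w : Fin L → A) [DecidableEq α]

lemma labelSum_true_eq {m : Fin 3 → ℕ} (hm : ∀ i, 0 < m i) :
    labelSum w m (fun (_ : Fin L → Perm α) _ => True) =
      labelSum w m (fun (g : Fin L → Perm α) _ =>
        ActsTransitively (Subgroup.closure (Set.range g))) +
      ∑ i, labelSum w m (fun (g : Fin L → Perm α) φ => Separates {i} g φ) -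
      2 * labelSum w m (fun (g : Fin L → Perm α) φ => Separates Set.univ g φ) := by
  classical
  have hite : ∀ P : (Fin L → Perm α) → (α → Fin 3) → Prop, labelSum w m P =
      ∑ x : (Fin L → Perm α) × (α → Fin 3) with IsLabel (List.ofFn x.1).prod m x.2,
        wt w x.1 * if P x.1 x.2 then 1 else 0 := by
    intro P
    simp only [mul_ite, mul_one, mul_zero]
    rw [labelSum, ← Finset.sum_filter, Finset.filter_filter]
  simp only [hite]
  rw [Finset.sum_comm, Finset.mul_sum, ← Finset.sum_add_distrib, ← Finset.sum_sub_distrib]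
  refine Finset.sum_congr rfl fun y hy => ?_
  have := (Finset.mem_filter.1 hy).2.indicator_eq (A := A) hm
  rw [if_pos trivial, ← Finset.mul_sum]
  linear_combination wt w y.1 * this

end InclusionExclusion

end WHN

namespace WHN

open Equiv Polynomial

section Generating

variable {R : Type*} [CommRing R] [Algebra ℚ R] {L : ℕ} (c : Fin L → R)

lemma tupleSum_eq_factorial_mul_genH (N : ℕ) (M : Multiset ℕ)
    (Q : Subgroup (Perm (Fin N)) → Prop) :
    tupleSum (fun j => C (c j) * X) (Fin N) M Q = (N.factorial : R[X]) * genH c N M Q := by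
  have h : (N.factorial : R[X]) = C (algebraMap ℚ R N.factorial) := by simp
  rw [genH, h, ← mul_assoc, ← C_mul, ← map_mul,
    mul_inv_cancel₀ (Nat.cast_ne_zero.2 N.factorial_ne_zero)]
  simp

variable {ι : Type*} [Fintype ι] [DecidableEq ι] {m : ι → ℕ}

lemma labelSum_closure_eq_genH (hm : ∀ i, 0 < m i) (N : ℕ) (Q : Subgroup (Perm (Fin N)) → Prop) :
    labelSum (fun j => C (c j) * X) m
        (fun g (_ : Fin N → ι) => Q (Subgroup.closure (Set.range g))) =
      (N.factorial : R[X]) * ((autCard (Finset.univ.val.map m) : R[X]) *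
        genH c N (Finset.univ.val.map m) Q) := by
  rw [labelSum_closure _ _ hm, tupleSum_eq_factorial_mul_genH, mul_left_comm]

lemma labelSum_eq_genH_mul {T : Set ι} {i : ι} (hi : i ∈ T) (hm : 0 < m i) {N a n : ℕ}
    (ha : m i = a) (hN : N = a + n) {F : R[X]}
    (hF : labelSum (fun j => C (c j) * X) (m ∘ Subtype.val : {k // k ≠ i} → ℕ)
      (fun (g : Fin L → Perm (Fin n)) φ => Separates (Subtype.val ⁻¹' T) g φ) =
        (n.factorial : R[X]) * F) :
    labelSum (fun j => C (c j) * X) m (fun (g : Fin L → Perm (Fin N)) φ => Separates T g φ) =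
      (N.factorial : R[X]) * (genH c a {a} (fun _ => True) * F) := by
  subst ha hN
  rw [labelSum_separates (α := Fin (m i)) (β := Fin n) _ hi hm (by simp) (by simp), hF,
    tupleSum_eq_factorial_mul_genH]
  have h := Nat.choose_mul_factorial_mul_factorial (Nat.le_add_right (m i) n)
  rw [Nat.add_sub_cancel_left] at h
  simp only [Fintype.card_fin]
  rw [← h]
  push_cast
  ring

lemma labelSum_eq_genH_of_forall (hm : ∀ i, 0 < m i) {N : ℕ} {T : Set ι}
    (hT : ∀ (g : Fin L → Perm (Fin N)) (φ : Fin N → ι), Separates T g φ) :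
    labelSum (fun j => C (c j) * X) m (fun (g : Fin L → Perm (Fin N)) φ => Separates T g φ) =
      (N.factorial : R[X]) * ((autCard (Finset.univ.val.map m) : R[X]) *
        genH c N (Finset.univ.val.map m) fun _ => True) := by
  rw [← labelSum_closure_eq_genH c hm]
  exact labelSum_congr _ _ fun g φ _ => iff_of_true (hT g φ) trivial

lemma labelSum_singleton_eq_genH (hm : ∀ i, 0 < m i) (i : ι) {N a n : ℕ} (ha : m i = a)
    (hN : N = a + n) :
    labelSum (fun j => C (c j) * X) m (fun (g : Fin L → Perm (Fin N)) φ => Separates {i} g φ) =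
      (N.factorial : R[X]) * (genH c a {a} (fun _ => True) *
        ((autCard (Finset.univ.val.map (m ∘ Subtype.val : {k // k ≠ i} → ℕ)) : R[X]) *
          genH c n (Finset.univ.val.map (m ∘ Subtype.val : {k // k ≠ i} → ℕ)) fun _ => True)) := by
  refine labelSum_eq_genH_mul c (Set.mem_singleton i) (hm i) ha hN ?_
  exact labelSum_eq_genH_of_forall (ι := {k // k ≠ i}) c (fun k => hm k) fun _ _ k hk =>
    absurd (Set.mem_singleton_iff.1 hk) k.2

lemma labelSum_univ_eq_genH (hm : ∀ i, 0 < m i) (i : ι) (j : {k // k ≠ i})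
    (h : Subsingleton {k // k ≠ j}) {N a b n l : ℕ} (ha : m i = a)
    (hb : m j = b) (hN : N = a + n) (hn : n = b + l) :
    labelSum (fun j => C (c j) * X) m
        (fun (g : Fin L → Perm (Fin N)) φ => Separates Set.univ g φ) =
      (N.factorial : R[X]) * (genH c a {a} (fun _ => True) *
        (genH c b {b} (fun _ => True) * ((autCard (Finset.univ.val.map
          ((m ∘ Subtype.val) ∘ Subtype.val : {k // k ≠ j} → ℕ)) : R[X]) *
          genH c l (Finset.univ.val.map
            ((m ∘ Subtype.val) ∘ Subtype.val : {k // k ≠ j} → ℕ)) fun _ => True))) := by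
  refine labelSum_eq_genH_mul c (Set.mem_univ i) (hm i) ha hN ?_
  refine labelSum_eq_genH_mul c (m := m ∘ Subtype.val) (Set.mem_univ j) (hm j) hb hn ?_
  exact labelSum_eq_genH_of_forall (ι := {k // k ≠ j}) c (fun k => hm k)
    fun _ _ => separates_of_subsingleton _ _ _

lemma genH_three_parts {m1 m2 m3 : ℕ} (h1 : 0 < m1) (h2 : 0 < m2) (h3 : 0 < m3) :
    (autCard {m1, m2, m3} : R[X]) * genH c (m1 + m2 + m3) {m1, m2, m3} (fun _ => True) =
      (autCard {m1, m2, m3} : R[X]) * genH c (m1 + m2 + m3) {m1, m2, m3} ActsTransitively +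
      ((autCard {m2, m3} : R[X]) * (genH c m1 {m1} (fun _ => True) *
          genH c (m2 + m3) {m2, m3} fun _ => True) +
        (autCard {m1, m3} : R[X]) * (genH c m2 {m2} (fun _ => True) *
          genH c (m1 + m3) {m1, m3} fun _ => True) +
        (autCard {m1, m2} : R[X]) * (genH c m3 {m3} (fun _ => True) *
          genH c (m1 + m2) {m1, m2} fun _ => True) -
        2 * (genH c m2 {m2} (fun _ => True) * (genH c m1 {m1} (fun _ => True) *
          genH c m3 {m3} fun _ => True))) := by
  have hm : ∀ i, 0 < ![m1, m2, m3] i := by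
    simp [Fin.forall_fin_succ, h1, h2, h3]
  have hall := labelSum_closure_eq_genH c hm (m1 + m2 + m3) fun _ => True
  have htrans := labelSum_closure_eq_genH c hm (m1 + m2 + m3) ActsTransitively
  have hs0 := labelSum_singleton_eq_genH c hm 0 (N := m1 + m2 + m3) (a := m1)
    (n := m2 + m3) rfl (by ring)
  have hs1 := labelSum_singleton_eq_genH c hm 1 (N := m1 + m2 + m3) (a := m2)
    (n := m1 + m3) rfl (by ring)
  have hs2 := labelSum_singleton_eq_genH c hm 2 (N := m1 + m2 + m3) (a := m3)
    (n := m1 + m2) rfl (by ring)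
  have huniv := labelSum_univ_eq_genH c hm 0 ⟨1, by decide⟩ ⟨by decide⟩
    (N := m1 + m2 + m3) (a := m1) (b := m2) (n := m2 + m3) (l := m3) rfl rfl (by ring) rfl
  have e3 : Finset.univ.val.map ![m1, m2, m3] = {m1, m2, m3} := rfl
  have e0 : Finset.univ.val.map (![m1, m2, m3] ∘ Subtype.val : {k : Fin 3 // k ≠ 0} → ℕ) =
    {m2, m3} := rfl
  have e1 : Finset.univ.val.map (![m1, m2, m3] ∘ Subtype.val : {k : Fin 3 // k ≠ 1} → ℕ) =
    {m1, m3} := rfl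
  have e2 : Finset.univ.val.map (![m1, m2, m3] ∘ Subtype.val : {k : Fin 3 // k ≠ 2} → ℕ) =
    {m1, m2} := rfl
  have e01 : Finset.univ.val.map ((![m1, m2, m3] ∘ Subtype.val) ∘ Subtype.val :
    {k : {k : Fin 3 // k ≠ 0} // k ≠ ⟨1, by decide⟩} → ℕ) = {m3} := rfl
  have ha : autCard {m3} = 1 := by simp [autCard]
  have key := labelSum_true_eq (α := Fin (m1 + m2 + m3)) (fun j => C (c j) * X) hm
  rw [Fin.sum_univ_three, hall, htrans, hs0, hs1, hs2, huniv, e0, e1, e2, e3, e01, ha] at key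
  rw [Nat.cast_one, one_mul] at key
  have hunit : IsUnit ((m1 + m2 + m3).factorial : R[X]) := by
    have h : IsUnit ((m1 + m2 + m3).factorial : ℚ) :=
      (Nat.cast_ne_zero.2 (Nat.factorial_ne_zero _)).isUnit
    simpa using h.map (algebraMap ℚ R[X])
  refine hunit.mul_left_cancel ?_
  linear_combination key

end Generating

end WHN

open WHN in
/-- Nonconnected from connected, length 3:
`H^d_G((μ₁,μ₂,μ₃)) = H̃^d_G((μ₁,μ₂,μ₃)) + (1/|aut(μ₁,μ₂,μ₃)|) Σ_{k=0}^{d} [`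
`|aut(μ₂,μ₃)| H^k_G((μ₁)) H^{d−k}_G((μ₂,μ₃)) + |aut(μ₁,μ₃)| H^k_G((μ₂)) H^{d−k}_G((μ₁,μ₃))`
`+ |aut(μ₁,μ₂)| H^k_G((μ₃)) H^{d−k}_G((μ₁,μ₂))`
`− 2 Σ_{j=0}^{d−k} H^j_G((μ₁)) H^k_G((μ₂)) H^{d−j−k}_G((μ₃)) ]`. -/
theorem statement11 {R : Type*} [CommRing R] [Algebra ℚ R] {L : ℕ} (hL : 1 ≤ L)
    (c : Fin L → R) (μ1 μ2 μ3 : ℕ) (h21 : μ2 ≤ μ1) (h32 : μ3 ≤ μ2) (h3 : 1 ≤ μ3)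
    (d : ℕ) :
    weightedH c d (part3 μ1 μ2 μ3 (h3.trans (h32.trans h21)) (h3.trans h32) h3) =
      weightedHconn c d (part3 μ1 μ2 μ3 (h3.trans (h32.trans h21)) (h3.trans h32) h3) +
        algebraMap ℚ R ((autCard {μ1, μ2, μ3} : ℚ)⁻¹) *
          ∑ k ∈ Finset.range (d + 1),
            ((autCard {μ2, μ3} : R) * (weightedH c k (part1 μ1) *
                weightedH c (d - k) (part2 μ2 μ3 (h3.trans h32) h3)) +
              (autCard {μ1, μ3} : R) * (weightedH c k (part1 μ2) *
                weightedH c (d - k) (part2 μ1 μ3 (h3.trans (h32.trans h21)) h3)) +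
              (autCard {μ1, μ2} : R) * (weightedH c k (part1 μ3) *
                weightedH c (d - k) (part2 μ1 μ2 (h3.trans (h32.trans h21)) (h3.trans h32))) -
              2 * ∑ j ∈ Finset.range (d - k + 1),
                weightedH c j (part1 μ1) * weightedH c k (part1 μ2) *
                  weightedH c (d - j - k) (part1 μ3)) := by
  have h1 : 0 < μ1 := h3.trans (h32.trans h21)
  have h2 : 0 < μ2 := h3.trans h32
  have p1 : ∀ m : ℕ, 0 < m → (part1 m).parts = {m} := fun m hm =>
    Nat.Partition.indiscrete_parts hm.ne'
  have key := congrArg (fun P : Polynomial R => P.coeff d) (genH_three_parts c h1 h2 h3)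
  have hcast : ∀ (n : ℕ) (P : Polynomial R), ((n : Polynomial R) * P).coeff d = n * P.coeff d :=
    fun n P => by rw [← nsmul_eq_mul, Polynomial.coeff_smul, nsmul_eq_mul]
  have htwo : ∀ P : Polynomial R, ((2 : Polynomial R) * P).coeff d = 2 * P.coeff d :=
    fun P => by exact_mod_cast hcast 2 P
  have hunit : algebraMap ℚ R ((autCard {μ1, μ2, μ3} : ℚ)⁻¹) * (autCard {μ1, μ2, μ3} : R) = 1 := by
    have h : (autCard {μ1, μ2, μ3} : ℚ) ≠ 0 :=
      Nat.cast_ne_zero.2 (Finset.prod_ne_zero_iff.2 fun _ _ => Nat.factorial_ne_zero _)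
    rw [← map_natCast (algebraMap ℚ R), ← map_mul, inv_mul_cancel₀ h, map_one]
  simp only [Polynomial.coeff_add, Polynomial.coeff_sub, hcast, htwo, Polynomial.coeff_mul,
    Finset.Nat.sum_antidiagonal_eq_sum_range_succ_mk, Nat.succ_eq_add_one] at key
  simp only [weightedH_eq_coeff, weightedHconn_eq_coeff, p1 _ h1, p1 _ h2, p1 _ h3, part2, part3,
    Finset.sum_add_distrib, Finset.sum_sub_distrib, ← Finset.mul_sum]
  have htriple : ∀ k j, d - j - k = d - k - j := fun k j => Nat.sub_right_comm d j k
  simp only [htriple, mul_comm (Polynomial.coeff (genH c μ1 {μ1} fun _ => True) _)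
    (Polynomial.coeff (genH c μ2 {μ2} fun _ => True) _), mul_assoc, ← Finset.mul_sum]
  linear_combination (algebraMap ℚ R ((autCard {μ1, μ2, μ3} : ℚ)⁻¹)) * key -
    ((genH c (μ1 + μ2 + μ3) {μ1, μ2, μ3} fun _ => True).coeff d -
      (genH c (μ1 + μ2 + μ3) {μ1, μ2, μ3} ActsTransitively).coeff d) * hunit
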